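/- (Lemma 4.3, coarse bound for the non-stationary policy) Assume ε ∈ (0,1]. There exist constants C > 0 and c₁, c₂ ≥ 1, all independent of H, X, A, ε, and δ, such that when the sample-based MDVI algorithm is run with α = γ, K = ⌈(3/(1−α))·log(c₁H/ε) + 2⌉, and M = ⌈(c₂H²/ε²)·log(16KXA/δ)⌉, then on the event 𝓔₁ its output policies satisfy ‖V* − V^{π'_k}‖_∞ ≤ 2(k+H)γ^k + C·ε·√(H/c₂) for all k ∈ {1,…,K}, and moreover ‖V* − V^{π'_K}‖_∞ ≤ √H·ε. -/

import Mathlib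

open MeasureTheory ProbabilityTheory Finset Real

noncomputable section

/-- The transition kernel `P` applied to a state-value function:
`(Pv)(x,a) = Σ_z P(z|x,a) v(z)`. -/
def mdpP {S A : Type} [Fintype S] (P : S → A → S → ℝ) (v : S → ℝ) : S → A → ℝ :=
  fun x a => ∑ z, P x a z * v z

/-- A policy applied to a Q-function: `(poq)(x) = Σ_a po(a|x) q(x,a)`. -/
def polAct {S A : Type} [Fintype A] (po : S → A → ℝ) (q : S → A → ℝ) : S → ℝ :=
  fun x => ∑ a, po x a * q x a

/-- `P` is a transition kernel. -/
def IsKernel {S A : Type} [Fintype S] (P : S → A → S → ℝ) : Prop :=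
  (∀ x a z, 0 ≤ P x a z) ∧ ∀ x a, ∑ z, P x a z = 1

/-- `po` is a (Markov) policy. -/
def IsPolicy {S A : Type} [Fintype A] (po : S → A → ℝ) : Prop :=
  (∀ x a, 0 ≤ po x a) ∧ ∀ x, ∑ a, po x a = 1

/-- The deterministic policy induced by `d : S → A`. -/
def detPol {S A : Type} [DecidableEq A] (d : S → A) : S → A → ℝ :=
  fun x a => if a = d x then 1 else 0

/-- The Bellman operator `T^po q = r + γ P (po q)`. -/
def bellmanOp {S A : Type} [Fintype S] [Fintype A] (P : S → A → S → ℝ) (r : S → A → ℝ)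
    (γ : ℝ) (po : S → A → ℝ) (qf : S → A → ℝ) : S → A → ℝ :=
  fun x a => r x a + γ * mdpP P (polAct po qf) x a

/-- `P^po = Ppo` acting on Q-functions. -/
def Ppi {S A : Type} [Fintype S] [Fintype A] (P : S → A → S → ℝ) (po : S → A → ℝ)
    (qf : S → A → ℝ) : S → A → ℝ :=
  mdpP P (polAct po qf)

/-- `PprodN P po j n` is `P^{po_{j+n-1}} ⋯ P^{po_j}` (`n` factors, identity for `n = 0`);
this is `P_j^i` of the paper with `n = i + 1 - j` factors. -/
def PprodN {S A : Type} [Fintype S] [Fintype A] (P : S → A → S → ℝ)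
    (po : ℕ → S → A → ℝ) (j : ℕ) : ℕ → (S → A → ℝ) → S → A → ℝ
  | 0, qf => qf
  | n + 1, qf => Ppi P (po (j + n)) (PprodN P po j n qf)

/-- The conditional standard deviation `σ(v)(x,a) = √(P(v²)(x,a) − (Pv)(x,a)²)`. -/
def sigmaP {S A : Type} [Fintype S] (P : S → A → S → ℝ) (v : S → ℝ) : S → A → ℝ :=
  fun x a => Real.sqrt (mdpP P (fun z => v z ^ 2) x a - (mdpP P v x a) ^ 2)

/-- `𝒩^po = Σ_{t=0}^∞ (γ po P)^t` acting on state-value functions. -/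
def Npol {S A : Type} [Fintype S] [Fintype A] (P : S → A → S → ℝ) (γ : ℝ)
    (po : S → A → ℝ) (vf : S → ℝ) : S → ℝ :=
  fun x => ∑' t : ℕ, ((fun uf : S → ℝ => fun z => γ * polAct po (mdpP P uf) z)^[t] vf) x

section Averages

variable {S A : Type}

theorem weightedSum_le {ι : Type} [Fintype ι] {p f : ι → ℝ} {B : ℝ} (hp : ∀ i, 0 ≤ p i)
    (hp1 : ∑ i, p i = 1) (hf : ∀ i, f i ≤ B) : ∑ i, p i * f i ≤ B :=
  calc ∑ i, p i * f i ≤ ∑ i, p i * B :=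
        Finset.sum_le_sum fun i _ => mul_le_mul_of_nonneg_left (hf i) (hp i)
    _ = B := by rw [← Finset.sum_mul, hp1, one_mul]

theorem le_weightedSum {ι : Type} [Fintype ι] {p f : ι → ℝ} {B : ℝ} (hp : ∀ i, 0 ≤ p i)
    (hp1 : ∑ i, p i = 1) (hf : ∀ i, B ≤ f i) : B ≤ ∑ i, p i * f i :=
  calc B = ∑ i, p i * B := by rw [← Finset.sum_mul, hp1, one_mul]
    _ ≤ ∑ i, p i * f i :=
        Finset.sum_le_sum fun i _ => mul_le_mul_of_nonneg_left (hf i) (hp i)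

theorem mdpP_sub_const_mul [Fintype S] (P : S → A → S → ℝ) (v w : S → ℝ) (c : ℝ) (x : S) (a : A) :
    mdpP P (fun z => v z - c * w z) x a = mdpP P v x a - c * mdpP P w x a := by
  simp only [mdpP, Finset.mul_sum, ← Finset.sum_sub_distrib]
  exact Finset.sum_congr rfl fun z _ => by ring

theorem mdpP_mono [Fintype S] {P : S → A → S → ℝ} (hP : IsKernel P) {v w : S → ℝ}
    (h : ∀ z, v z ≤ w z) (x : S) (a : A) : mdpP P v x a ≤ mdpP P w x a :=
  Finset.sum_le_sum fun z _ => mul_le_mul_of_nonneg_left (h z) (hP.1 x a z)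

theorem polAct_detPol [Fintype A] [DecidableEq A] (d : S → A) (q : S → A → ℝ) (x : S) :
    polAct (detPol d) q x = q x (d x) := by
  simp [polAct, detPol]

theorem isPolicy_detPol [Fintype A] [DecidableEq A] (d : S → A) : IsPolicy (detPol d) := by
  refine ⟨fun x a => ?_, fun x => by simp [detPol]⟩
  unfold detPol
  split_ifs <;> norm_num

end Averages

section Values

variable {S A : Type} [Fintype S] [Fintype A] {P : S → A → S → ℝ} {r : S → A → ℝ} {γ H : ℝ}

theorem abs_value_le (hP : IsKernel P) (hr : ∀ x a, |r x a| ≤ 1) (hγ0 : 0 ≤ γ)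
    (hγ1 : γ < 1) (hH : H * (1 - γ) = 1) {po : S → A → ℝ} (hpo : IsPolicy po) {V : S → ℝ}
    (hV : ∀ x, V x = polAct po (fun x a => r x a + γ * mdpP P V x a) x) (x : S) : |V x| ≤ H := by
  have : Nonempty S := ⟨x⟩
  obtain ⟨x₀, hx₀⟩ := Finite.exists_max fun x => |V x|
  have hPV : ∀ x a, |mdpP P V x a| ≤ |V x₀| := fun x a => abs_le.2
    ⟨le_weightedSum (hP.1 x a) (hP.2 x a) fun z => (abs_le.1 (hx₀ z)).1,
      weightedSum_le (hP.1 x a) (hP.2 x a) fun z => (abs_le.1 (hx₀ z)).2⟩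
  have hb : ∀ x a, |r x a + γ * mdpP P V x a| ≤ 1 + γ * |V x₀| := fun x a =>
    (abs_add_le _ _).trans <| add_le_add (hr x a) <| by
      rw [abs_mul, abs_of_nonneg hγ0]
      exact mul_le_mul_of_nonneg_left (hPV x a) hγ0
  have h₀ : |V x₀| ≤ 1 + γ * |V x₀| := by
    conv_lhs => rw [hV x₀]
    exact abs_le.2
      ⟨le_weightedSum (hpo.1 x₀) (hpo.2 x₀) fun a => (abs_le.1 (hb x₀ a)).1,
        weightedSum_le (hpo.1 x₀) (hpo.2 x₀) fun a => (abs_le.1 (hb x₀ a)).2⟩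
  refine (hx₀ x).trans ?_
  nlinarith

/-- The value of an optimal policy dominates its own one-step lookahead. -/
theorem lookahead_le_of_optimal [Nonempty A] [DecidableEq A] (hP : IsKernel P) (hγ0 : 0 ≤ γ)
    (hγ1 : γ < 1) {pstar : S → A → ℝ} (hpstar : IsPolicy pstar) {V : S → ℝ}
    (hV : ∀ x, V x = polAct pstar (fun x a => r x a + γ * mdpP P V x a) x)
    (Vdet : (S → A) → S → ℝ)
    (hVdet : ∀ d x, Vdet d x = r x (d x) + γ * mdpP P (Vdet d) x (d x))
    (hopt : ∀ d x, Vdet d x ≤ V x) (x : S) (a : A) : r x a + γ * mdpP P V x a ≤ V x := by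
  choose d hd using fun x => Finite.exists_max fun a => r x a + γ * mdpP P V x a
  have hVd : ∀ x, V x ≤ r x (d x) + γ * mdpP P V x (d x) := fun x => by
    conv_lhs => rw [hV x]
    exact weightedSum_le (hpstar.1 x) (hpstar.2 x) (hd x)
  have : Nonempty S := ⟨x⟩
  obtain ⟨x₀, hx₀⟩ := Finite.exists_min fun x => Vdet d x - V x
  have hmin : ∀ x a, Vdet d x₀ - V x₀ ≤ mdpP P (Vdet d) x a - mdpP P V x a := fun x a => by
    have h := mdpP_sub_const_mul P (Vdet d) V 1 x a
    simp only [one_mul] at h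
    rw [← h]
    exact le_weightedSum (hP.1 x a) (hP.2 x a) hx₀
  have h₀ : 0 ≤ Vdet d x₀ - V x₀ := by
    have h₁ := hVdet d x₀
    have h₂ := hVd x₀
    have h₃ := mul_le_mul_of_nonneg_left (hmin x₀ (d x₀)) hγ0
    nlinarith
  have heq : Vdet d = V := funext fun z =>
    le_antisymm (hopt d z) (by linarith [hx₀ z])
  have hfix := hVdet d x
  rw [heq] at hfix
  exact (hd x a).trans hfix.ge

end Values

section Iterates

variable {S A : Type} [Fintype S]

/-- The cumulated iterate of MDVI in closed form. -/
theorem mdvi_iterate_eq {P : S → A → S → ℝ} {r : S → A → ℝ} {γ H : ℝ} (hH : H * (1 - γ) = 1)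
    {w v : ℕ → S → ℝ} {sq εf Ef : ℕ → S → A → ℝ}
    (hs0 : ∀ x a, sq 0 x a = 0) (hw0 : ∀ x, w 0 x = 0)
    (hv : ∀ k x, v k x = w k x - γ * w (k - 1) x)
    (hsq : ∀ k x a, sq (k + 1) x a = r x a + γ * mdpP P (v k) x a + εf (k + 1) x a + γ * sq k x a)
    (hEf : ∀ k x a, Ef k x a = ∑ j ∈ Finset.range k, γ ^ (k - 1 - j) * εf (j + 1) x a)
    (k : ℕ) (x : S) (a : A) :
    sq (k + 1) x a = H * (1 - γ ^ (k + 1)) * r x a + γ * mdpP P (w k) x a + Ef (k + 1) x a := by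
  induction k with
  | zero =>
    have hv0 : v 0 = w 0 := funext fun z => by simp [hv, hw0]
    rw [hsq, hs0, hEf, hv0, zero_add, pow_one, hH]
    simp
  | succ k ih =>
    have hvk : v (k + 1) = fun z => w (k + 1) z - γ * w k z := funext fun z => hv (k + 1) z
    have hE : Ef (k + 2) x a = γ * Ef (k + 1) x a + εf (k + 2) x a := by
      rw [hEf, hEf, Finset.sum_range_succ, Finset.mul_sum]
      congr 1
      · refine Finset.sum_congr rfl fun j hj => ?_
        have hj' := Finset.mem_range.1 hj
        rw [show k + 2 - 1 - j = (k + 1 - 1 - j) + 1 by omega, pow_succ]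
        ring
      · simp
    rw [hsq, ih, hvk, mdpP_sub_const_mul, hE]
    linear_combination (-r x a) * hH

/-- Coarse bound on the gap between `V` and the values `U k` of the non-stationary policies. -/
theorem value_gap_le [Fintype A] {P : S → A → S → ℝ} (hP : IsKernel P) {r : S → A → ℝ}
    (hr : ∀ x a, |r x a| ≤ 1) {γ H e : ℝ} (hγ0 : 0 ≤ γ) (hH0 : 0 < H)
    (hH : H * (1 - γ) = 1) (he : 0 ≤ e) {pstar : S → A → ℝ} (hpstar : IsPolicy pstar)
    {V : S → ℝ} (hV : ∀ x, V x = polAct pstar (fun x a => r x a + γ * mdpP P V x a) x)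
    (hVH : ∀ x, |V x| ≤ H) {w U : ℕ → S → ℝ} {sq Ef : ℕ → S → A → ℝ} {pol : ℕ → S → A}
    (hw0 : ∀ x, w 0 x = 0)
    (hs : ∀ k x a, sq (k + 1) x a
      = H * (1 - γ ^ (k + 1)) * r x a + γ * mdpP P (w k) x a + Ef (k + 1) x a)
    (hw : ∀ k x, w (k + 1) x = sq (k + 1) x (pol (k + 1) x))
    (hgreedy : ∀ k x a, sq k x a ≤ sq k x (pol k x))
    (hU0 : ∀ x, |U 0 x| ≤ H)
    (hU : ∀ k x, U (k + 1) x = r x (pol (k + 1) x) + γ * mdpP P (U k) x (pol (k + 1) x))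
    {K : ℕ} (hE : ∀ k ∈ Finset.Icc 1 K, ∀ x a, |Ef k x a| ≤ e) {k : ℕ} (hk : k ≤ K) (x : S) :
    V x - U k x ≤ 2 * (k + H) * γ ^ k + 2 * e := by
  have key : ∀ k ≤ K, ∀ x,
      w k x - H * U k x ≤ (k + H) * γ ^ k * H + e * H ∧
      -((k + H) * γ ^ k * H + e * H) ≤ w k x - H * V x := by
    intro k
    induction k with
    | zero =>
      intro _ x
      have h₁ := abs_le.1 (hU0 x)
      have h₂ := abs_le.1 (hVH x)
      have h₃ : 0 ≤ e * H := by positivity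
      simp only [hw0, Nat.cast_zero, pow_zero]
      constructor <;> nlinarith
    | succ k ih =>
      intro hk x
      have ih := ih (by omega)
      set b : ℝ := (k + H) * γ ^ k * H + e * H with hb
      have hstep : ((k + 1 : ℕ) + H) * γ ^ (k + 1) * H + e * H = γ * b + γ ^ (k + 1) * H + e := by
        rw [hb]
        push_cast
        linear_combination e * hH
      have hr' : ∀ a, |γ ^ (k + 1) * H * r x a| ≤ γ ^ (k + 1) * H := fun a => by
        rw [abs_mul, abs_of_nonneg (by positivity)]
        exact mul_le_of_le_one_right (by positivity) (hr x a)
      have hE' : ∀ a, |Ef (k + 1) x a| ≤ e :=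
        hE (k + 1) (Finset.mem_Icc.2 ⟨by omega, hk⟩) x
      rw [hstep]
      constructor
      · set a := pol (k + 1) x with ha
        have hD : mdpP P (fun z => w k z - H * U k z) x a ≤ b :=
          weightedSum_le (hP.1 x a) (hP.2 x a) fun z => (ih z).1
        rw [mdpP_sub_const_mul] at hD
        have hD' := mul_le_mul_of_nonneg_left hD hγ0
        have h₁ := abs_le.1 (hr' a)
        have h₂ := abs_le.1 (hE' a)
        rw [hw, hs, hU, ← ha]
        linarith
      · have hF : ∀ a, H * (r x a + γ * mdpP P V x a)
            ≤ w (k + 1) x + (γ * b + γ ^ (k + 1) * H + e) := fun a => by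
          have hF : -b ≤ mdpP P (fun z => w k z - H * V z) x a :=
            le_weightedSum (hP.1 x a) (hP.2 x a) fun z => (ih z).2
          rw [mdpP_sub_const_mul] at hF
          have hF' := mul_le_mul_of_nonneg_left hF hγ0
          have h₁ := abs_le.1 (hr' a)
          have h₂ := abs_le.1 (hE' a)
          have h₃ := hgreedy (k + 1) x a
          rw [← hw, hs] at h₃
          linarith
        have hsum : H * V x = ∑ a, pstar x a * (H * (r x a + γ * mdpP P V x a)) := by
          conv_lhs => rw [hV x, polAct, Finset.mul_sum]
          exact Finset.sum_congr rfl fun a _ => by ring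
        have := weightedSum_le (hpstar.1 x) (hpstar.2 x) hF
        linarith
  obtain ⟨h₁, h₂⟩ := key k hk x
  refine le_of_mul_le_mul_left ?_ hH0
  linarith

end Iterates

section Constants

/-- Sampling error under the prescribed number of samples. -/
theorem mdvi_error_le {H ε c ι ι' M : ℝ} (hH : 0 < H) (hε : 0 < ε) (hc : 0 < c) (hM : 0 < M)
    (hι : ι ≤ ι') (hM' : c * H ^ 2 / ε ^ 2 * ι' ≤ M) :
    3 * H * Real.sqrt (H * ι / M) ≤ 3 * ε * Real.sqrt (H / c) := by
  have h : H * ι / M ≤ (ε / H) ^ 2 * (H / c) := by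
    have h₁ : c * H ^ 2 / ε ^ 2 * ι ≤ M :=
      (mul_le_mul_of_nonneg_left hι (by positivity)).trans hM'
    rw [div_le_iff₀ hM]
    calc H * ι = (ε / H) ^ 2 * (H / c) * (c * H ^ 2 / ε ^ 2 * ι) := by field_simp
      _ ≤ _ := mul_le_mul_of_nonneg_left h₁ (by positivity)
  calc 3 * H * Real.sqrt (H * ι / M)
      ≤ 3 * H * Real.sqrt ((ε / H) ^ 2 * (H / c)) := by gcongr
    _ = 3 * ε * Real.sqrt (H / c) := by
      rw [Real.sqrt_mul (by positivity), Real.sqrt_sq (by positivity)]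
      field_simp

/-- Decay of the initialisation error under the prescribed number of iterations. -/
theorem mdvi_decay_le {γ H ε : ℝ} (hγ0 : 0 ≤ γ) (hH1 : 1 ≤ H) (hH : H * (1 - γ) = 1)
    (hε0 : 0 < ε) (hε1 : ε ≤ 1) {K : ℕ} (hK : 3 * H * Real.log (4 * H / ε) ≤ K) :
    2 * (K + H) * γ ^ K ≤ Real.sqrt H * ε / 2 := by
  have hH0 : 0 < H := by linarith
  set t : ℝ := K / H with ht
  set L := Real.log (4 * H / ε) with hL
  have htL : 3 * L ≤ t := by
    rw [ht, le_div_iff₀ hH0]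
    linarith
  have hγt : γ ^ K ≤ Real.exp (-t) := by
    have h1 : γ ≤ Real.exp (-(1 / H)) := by
      have h2 : γ = -(1 / H) + 1 := by
        field_simp
        linarith
      rw [h2]
      simpa using Real.add_one_le_exp (-(1 / H))
    calc γ ^ K ≤ Real.exp (-(1 / H)) ^ K := pow_le_pow_left₀ hγ0 h1 K
      _ = Real.exp (-t) := by
        rw [← Real.exp_nat_mul, ht]
        congr 1
        ring
  have ht0 : 0 ≤ t := by positivity
  have h1t : 1 + t ≤ 4 * Real.exp (t / 3) := by
    have := Real.add_one_le_exp (t / 3)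
    linarith
  have hexpL : Real.exp (-(2 * L)) = (ε / (4 * H)) ^ 2 := by
    rw [show -(2 * L) = (2 : ℕ) * (-L) by push_cast; ring, Real.exp_nat_mul, Real.exp_neg, hL,
      Real.exp_log (by positivity), inv_div]
  calc 2 * (K + H) * γ ^ K = 2 * H * (1 + t) * γ ^ K := by
        rw [ht]
        field_simp
        ring
    _ ≤ 2 * H * (4 * Real.exp (t / 3)) * Real.exp (-t) := by gcongr
    _ = 8 * H * Real.exp (-(2 * (t / 3))) := by
      rw [show -(2 * (t / 3)) = t / 3 + -t by ring, Real.exp_add]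
      ring
    _ ≤ 8 * H * Real.exp (-(2 * L)) := by
      gcongr
      linarith
    _ = ε * (ε / H) / 2 := by
      rw [hexpL]
      field_simp
      norm_num
    _ ≤ ε * 1 / 2 := by
      gcongr
      rw [div_le_one hH0]
      linarith
    _ ≤ Real.sqrt H * ε / 2 := by
      have := Real.one_le_sqrt.2 hH1
      nlinarith

end Constants

/-- Lemma 4.3: coarse bound for the non-stationary policy. -/
theorem mdvi_coarse_bound_nonstationary :
    ∃ C c₁ c₂ : ℝ, 0 < C ∧ 1 ≤ c₁ ∧ 1 ≤ c₂ ∧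
    ∀ (α : ℝ)
    (S A : Type) [Fintype S] [Fintype A] [Nonempty S] [Nonempty A] [DecidableEq A]
    (P : S → A → S → ℝ) (hP : IsKernel P)
    (r : S → A → ℝ) (hr : ∀ x a, |r x a| ≤ 1)
    (γ H : ℝ) (hγ0 : 0 ≤ γ) (hγ1 : γ < 1) (hH : H = 1 / (1 - γ))
    (Qpol : (S → A → ℝ) → S → A → ℝ)
    (hQ : ∀ po, IsPolicy po → bellmanOp P r γ po (Qpol po) = Qpol po)
    (pstar : S → A → ℝ) (hpstar : IsPolicy pstar)
    (hopt : ∀ po, IsPolicy po → ∀ x, polAct po (Qpol po) x ≤ polAct pstar (Qpol pstar) x)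
    (K M : ℕ) (hM : 1 ≤ M)
    (y : ℕ → ℕ → S → A → S)
    (w v : ℕ → S → ℝ) (sq qv : ℕ → S → A → ℝ)
    (hs0 : ∀ x a, sq 0 x a = 0) (hw0 : ∀ x, w 0 x = 0)
    (hv : ∀ k x, v k x = w k x - α * w (k - 1) x)
    (hqv : ∀ k x a, qv (k + 1) x a
      = r x a + (γ / (M : ℝ)) * ∑ m ∈ Finset.range M, v k (y k m x a))
    (hsq : ∀ k x a, sq (k + 1) x a = qv (k + 1) x a + α * sq k x a)
    (hwk : ∀ k x, w (k + 1) x = ⨆ a, sq (k + 1) x a)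
    (pol : ℕ → S → A)
    (hgreedy : ∀ k x a, sq k x a ≤ sq k x (pol k x))
    (εf Ef : ℕ → S → A → ℝ)
    (hεf : ∀ k x a, εf (k + 1) x a
      = (γ / (M : ℝ)) * ∑ m ∈ Finset.range M, v k (y k m x a) - γ * mdpP P (v k) x a)
    (hEf : ∀ k x a, Ef k x a = ∑ j ∈ Finset.range k, α ^ (k - 1 - j) * εf (j + 1) x a)
    (u : ℕ → S → A → ℝ)
    (hu0 : u 0 = Qpol (detPol (pol 0)))
    (hurec : ∀ k, u (k + 1) = bellmanOp P r γ (detPol (pol (k + 1))) (u k))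
    (ε : ℝ) (hε0 : 0 < ε) (hε1 : ε ≤ 1)
    (δ : ℝ) (hδ0 : 0 < δ) (hδ1 : δ < 1)
    (hαγ : α = γ)
    (hKdef : K = ⌈(3 / (1 - α)) * Real.log (c₁ * H / ε) + 2⌉₊)
    (hMdef : M = ⌈(c₂ * H ^ 2 / ε ^ 2) *
        Real.log ((16 * K * Fintype.card S * Fintype.card A : ℝ) / δ)⌉₊)
    (hE1 : ∀ k ∈ Finset.Icc 1 K, ∀ x a, |Ef k x a|
      < 3 * H * Real.sqrt (((1 : ℝ) / (1 - α)) *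
          Real.log ((8 * K * Fintype.card S * Fintype.card A : ℝ) / δ) / (M : ℝ))),
    (∀ k ∈ Finset.Icc 1 K, ∀ x,
      |polAct pstar (Qpol pstar) x - polAct (detPol (pol k)) (u (k - 1)) x| ≤
        2 * ((k : ℝ) + H) * γ ^ k + C * ε * Real.sqrt (H / c₂)) ∧
    (∀ x, |polAct pstar (Qpol pstar) x - polAct (detPol (pol K)) (u (K - 1)) x| ≤
        Real.sqrt H * ε) := by
  refine ⟨6, 4, 144, by norm_num, by norm_num, by norm_num, ?_⟩
  intro α S A _ _ _ _ _ P hP r hr γ H hγ0 hγ1 hH Qpol hQ pstar hpstar hopt K M hM y w v sq qv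
    hs0 hw0 hv hqv hsq hwk pol hgreedy εf Ef hεf hEf u hu0 hurec ε hε0 hε1 δ hδ0 hδ1 hαγ
    hKdef hMdef hE1
  subst hαγ
  have hH' : H * (1 - α) = 1 := by
    rw [hH]
    exact one_div_mul_cancel (by linarith)
  have hH1 : 1 ≤ H := by
    rw [hH, le_div_iff₀] <;> linarith
  have hH0 : 0 < H := by linarith
  have hvalue : ∀ po, IsPolicy po → ∀ x, polAct po (Qpol po) x
      = polAct po (fun x a => r x a + α * mdpP P (polAct po (Qpol po)) x a) x :=
    fun po hpo x => congrArg (fun q => polAct po q x) (hQ po hpo).symm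
  set V := polAct pstar (Qpol pstar) with hVdef
  have hV := hvalue pstar hpstar
  have hgreedyV : ∀ x a, r x a + α * mdpP P V x a ≤ V x :=
    lookahead_le_of_optimal hP hγ0 hγ1 hpstar hV
      (fun d => polAct (detPol d) (Qpol (detPol d)))
      (fun d x => by
        have h := hvalue _ (isPolicy_detPol d) x
        rwa [polAct_detPol d (fun x a => r x a + _)] at h)
      (fun d => hopt _ (isPolicy_detPol d))
  -- value of the non-stationary policy started at index `k`
  let U : ℕ → S → ℝ := fun k => polAct (detPol (pol k)) (u (k - 1))
  have hu : ∀ k x a, u k x a = r x a + α * mdpP P (U k) x a := by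
    intro k x a
    cases k with
    | zero =>
      have h := hQ _ (isPolicy_detPol (pol 0))
      rw [← hu0] at h
      exact (congrFun (congrFun h x) a).symm
    | succ k => rw [hurec]; rfl
  have hU : ∀ k x, U (k + 1) x
      = r x (pol (k + 1) x) + α * mdpP P (U k) x (pol (k + 1) x) := fun k x => by
    rw [← hu]
    exact polAct_detPol _ _ x
  have hU0V : U 0 = polAct (detPol (pol 0)) (Qpol (detPol (pol 0))) := by
    rw [← hu0]
  have hUV : ∀ k x, U k x ≤ V x := by
    intro k
    induction k with
    | zero =>
      rw [hU0V]
      exact hopt _ (isPolicy_detPol _)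
    | succ k ih =>
      intro x
      rw [hU]
      have := mul_le_mul_of_nonneg_left (mdpP_mono hP ih x (pol (k + 1) x)) hγ0
      linarith [hgreedyV x (pol (k + 1) x)]
  have hL : 0 ≤ Real.log (4 * H / ε) := by
    refine Real.log_nonneg ?_
    rw [le_div_iff₀ hε0]
    linarith
  have hKge : 3 * H * Real.log (4 * H / ε) + 2 ≤ K := by
    have := Nat.le_ceil (3 / (1 - α) * Real.log (4 * H / ε) + 2)
    rw [← hKdef] at this
    calc _ = 3 / (1 - α) * Real.log (4 * H / ε) + 2 := by rw [hH]; ring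
      _ ≤ _ := this
  have hK0 : (0 : ℝ) < K := by
    have : 0 ≤ 3 * H * Real.log (4 * H / ε) := by positivity
    linarith
  have hM0 : (0 : ℝ) < M := by exact_mod_cast hM
  have hS0 : (0 : ℝ) < Fintype.card S := by exact_mod_cast Fintype.card_pos
  have hA0 : (0 : ℝ) < Fintype.card A := by exact_mod_cast Fintype.card_pos
  have he : 3 * H * Real.sqrt (((1 : ℝ) / (1 - α)) *
      Real.log ((8 * K * Fintype.card S * Fintype.card A : ℝ) / δ) / (M : ℝ))
      ≤ 3 * ε * Real.sqrt (H / 144) := by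
    rw [← hH]
    refine mdvi_error_le (ι' := Real.log ((16 * K * Fintype.card S * Fintype.card A : ℝ) / δ))
      hH0 hε0 (by norm_num) hM0 ?_ ?_
    · refine Real.log_le_log (by positivity) ?_
      gcongr
      norm_num
    · have := Nat.le_ceil (144 * H ^ 2 / ε ^ 2 *
        Real.log ((16 * K * Fintype.card S * Fintype.card A : ℝ) / δ))
      rwa [← hMdef] at this
  have hs := mdvi_iterate_eq (P := P) (r := r) hH' hs0 hw0 hv
    (fun k x a => by rw [hsq, hqv, hεf]; ring) hEf
  have hw : ∀ k x, w (k + 1) x = sq (k + 1) x (pol (k + 1) x) := fun k x => by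
    rw [hwk]
    exact le_antisymm (ciSup_le fun a => hgreedy _ x a)
      (le_ciSup (Set.finite_range fun a => sq (k + 1) x a).bddAbove _)
  have hgap : ∀ k ≤ K, ∀ x, |V x - U k x|
      ≤ 2 * ((k : ℝ) + H) * α ^ k + 6 * ε * Real.sqrt (H / 144) := fun k hk x => by
    rw [abs_of_nonneg (sub_nonneg.2 (hUV k x))]
    have := value_gap_le hP hr hγ0 hH0 hH' (e := 3 * ε * Real.sqrt (H / 144))
      (by positivity) hpstar hV
      (abs_value_le hP hr hγ0 hγ1 hH' hpstar hV) hw0 hs hw hgreedy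
      (fun x => by
        rw [hU0V]
        exact abs_value_le hP hr hγ0 hγ1 hH' (isPolicy_detPol _)
          (hvalue _ (isPolicy_detPol _)) x)
      hU (fun k hk x a => ((hE1 k hk x a).le.trans he)) hk x
    linarith
  refine ⟨fun k hk => hgap k (Finset.mem_Icc.1 hk).2, fun x => (hgap K le_rfl x).trans ?_⟩
  have hdecay := mdvi_decay_le (K := K) hγ0 hH1 hH' hε0 hε1 (by linarith)
  have hsqrt : Real.sqrt (H / 144) = Real.sqrt H / 12 := by
    rw [Real.sqrt_div hH0.le, show (144 : ℝ) = 12 ^ 2 by norm_num, Real.sqrt_sq (by norm_num)]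
  rw [hsqrt]
  linarith
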